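/- arXiv:math/0507066 — 2 statements merged into one kernel-verified Lean document; each statement's English description precedes it below -/
import Mathlib

section
/- The space H^{2p+2+s}_ℓ(ℝ^{2p+1}) decomposes as the direct sum H^{2p+2+s}_ℓ(ℝ^{2p+1}) = H^{2p+1+s}_ℓ(ℝ^{2p+1}, T^p) ⊕ range(L_{B,ν}): every homogeneous degree-ℓ polynomial map f(x, ν, μ) with values in ℝ × ℂ^p can be written uniquely as the sum of a ν-independent T^p-equivariant polynomial map and an element of the range of the homological operator L_{B,ν}. -/
noncomputable section

open MeasureTheory Complex

abbrev V (p : ℕ) := ℝ × (Fin p → ℂ)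
abbrev W (p s : ℕ) := V p × ℝ × (Fin s → ℝ)

/-- The torus action on `ℝ × ℂ^p`. -/
def torusAct (p : ℕ) (θ : Fin p → ℝ) (x : V p) : V p :=
  (x.1, fun j => Complex.exp (Complex.I * θ j) * x.2 j)

/-- Variable index type for real coordinates on `W p s`. -/
abbrev HVar (p s : ℕ) := (Unit ⊕ Fin p × Bool) ⊕ Unit ⊕ Fin s

/-- Real coordinates of a point of `W p s`. -/
def coordsW {p s : ℕ} (w : W p s) : HVar p s → ℝ
  | .inl (.inl _) => w.1.1
  | .inl (.inr (j, b)) => if b then (w.1.2 j).re else (w.1.2 j).im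
  | .inr (.inl _) => w.2.1
  | .inr (.inr k) => w.2.2 k

/-- `f` is a real-valued homogeneous polynomial of degree `ℓ` in coords of `W p s`. -/
def IsHomogScalar (p s ℓ : ℕ) (f : W p s → ℝ) : Prop :=
  ∃ P : MvPolynomial (HVar p s) ℝ, P.IsHomogeneous ℓ ∧
    ∀ w, f w = MvPolynomial.eval (coordsW w) P

/-- Membership in `H^{2p+2+s}_ℓ(ℝ^{2p+1})`. -/
def MemH (p s ℓ : ℕ) (f : W p s → V p) : Prop :=
  IsHomogScalar p s ℓ (fun w => (f w).1) ∧
  ∀ j, IsHomogScalar p s ℓ (fun w => ((f w).2 j).re) ∧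
       IsHomogScalar p s ℓ (fun w => ((f w).2 j).im)

/-- ν-independence. -/
def NuIndep (p s : ℕ) (f : W p s → V p) : Prop :=
  ∀ x ν ν' μ, f (x, ν, μ) = f (x, ν', μ)

/-- Torus-equivariance. -/
def Equivar (p s : ℕ) (f : W p s → V p) : Prop :=
  ∀ θ x ν μ, f (torusAct p θ x, ν, μ) = torusAct p θ (f (x, ν, μ))

/-- The linear part `B(x) = (0, iω_1 x_1, …, iω_p x_p)`. -/
def Bmap (p : ℕ) (ω : Fin p → ℝ) (x : V p) : V p :=
  (0, fun j => Complex.I * (ω j : ℂ) * x.2 j)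

/-- The homological operator `L_{B,ν}`. -/
def Lop (p s : ℕ) (ω : Fin p → ℝ) (f : W p s → V p) : W p s → V p :=
  fun w => fderiv ℝ f w (Bmap p ω w.1, 0, 0) - Bmap p ω (f w)
    + w.2.1 • fderiv ℝ f w (((1 : ℝ), (0 : Fin p → ℂ)), 0, 0)

/-- Fundamental domain for the torus. -/
def torusBox (p : ℕ) : Set (Fin p → ℝ) := Set.univ.pi fun _ => Set.Icc 0 (2 * Real.pi)

/-- The averaging operator `Å`. -/
def Aop (p s : ℕ) (f : W p s → V p) : W p s → V p :=
  fun w => ((2 * Real.pi) ^ p)⁻¹ •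
    ∫ θ in torusBox p, torusAct p θ (f (torusAct p (-θ) w.1, 0, w.2.2))

-- radial side
abbrev VZ (p : ℕ) := ℝ × (Fin p → ℝ)
abbrev WZ (p s : ℕ) := VZ p × (Fin s → ℝ)

abbrev ZVar (p s : ℕ) := (Unit ⊕ Fin p) ⊕ Fin s

def coordsZ {p s : ℕ} (w : WZ p s) : ZVar p s → ℝ
  | .inl (.inl _) => w.1.1
  | .inl (.inr j) => w.1.2 j
  | .inr k => w.2 k

def IsHomogScalarZ (p s ℓ : ℕ) (f : WZ p s → ℝ) : Prop :=
  ∃ P : MvPolynomial (ZVar p s) ℝ, P.IsHomogeneous ℓ ∧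
    ∀ w, f w = MvPolynomial.eval (coordsZ w) P

/-- Membership in `H^{p+1+s}_ℓ(ℝ^{p+1}, Z_{2,p})`. -/
def MemZ (p s ℓ : ℕ) (g : WZ p s → VZ p) : Prop :=
  (IsHomogScalarZ p s ℓ fun w => (g w).1) ∧
  (∀ j, IsHomogScalarZ p s ℓ fun w => (g w).2 j) ∧
  (∀ lam : Fin p → ℝ, (∀ j, lam j = 1 ∨ lam j = -1) →
    ∀ ρ μ, g ((ρ.1, fun j => lam j * ρ.2 j), μ)
      = ((g (ρ, μ)).1, fun j => lam j * (g (ρ, μ)).2 j))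

/-- Inclusion of real radial coordinates into `ℝ × ℂ^p`. -/
def embZ (p : ℕ) (ρ : VZ p) : V p := (ρ.1, fun j => (ρ.2 j : ℂ))

/-- The operator Π extracting the radial part. -/
def Piop (p s : ℕ) (f : W p s → V p) : WZ p s → VZ p :=
  fun w => ((f (embZ p w.1, 0, w.2)).1, fun j => ((f (embZ p w.1, 0, w.2)).2 j).re)

def MuIndep (p s : ℕ) (f : W p s → V p) : Prop :=
  ∀ x ν μ μ', f (x, ν, μ) = f (x, ν, μ')

def VanishMu (p s : ℕ) (f : W p s → V p) : Prop :=
  ∀ x ν, f (x, ν, 0) = 0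

def MuIndepZ (p s : ℕ) (g : WZ p s → VZ p) : Prop :=
  ∀ ρ μ μ', g (ρ, μ) = g (ρ, μ')

def VanishMuZ (p s : ℕ) (g : WZ p s → VZ p) : Prop :=
  ∀ ρ, g (ρ, 0) = 0

end

noncomputable section

open Complex in
lemma hasDerivAt_torusAct (p : ℕ) (ω : Fin p → ℝ) (x : V p) (t : ℝ) :
    HasDerivAt (fun t : ℝ => torusAct p (t • ω) x) (Bmap p ω (torusAct p (t • ω) x)) t := by
  refine (hasDerivAt_const t x.1).prodMk (hasDerivAt_pi.2 fun j => ?_)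
  have h : HasDerivAt (fun t : ℝ => I * ((t * ω j : ℝ) : ℂ)) (I * ω j) t := by
    have := (((hasDerivAt_id t).mul_const (ω j)).ofReal_comp).const_mul I
    simpa using this
  refine (h.cexp.mul_const (x.2 j)).congr_deriv ?_
  simp only [torusAct, Pi.smul_apply, smul_eq_mul]
  ring

lemma torusAct_zero (p : ℕ) (x : V p) : torusAct p 0 x = x := by
  ext <;> simp [torusAct]

lemma norm_torusAct_le (p : ℕ) (θ : Fin p → ℝ) (x : V p) : ‖torusAct p θ x‖ ≤ ‖x‖ := by
  refine max_le (le_max_left _ _) (le_max_of_le_right ?_)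
  refine (pi_norm_le_iff_of_nonneg (norm_nonneg _)).2 fun j => ?_
  simpa [torusAct, Complex.norm_exp] using norm_le_pi_norm x.2 j

section

variable {p s : ℕ}

/-- The homological operator on complex-valued functions, `c` being the eigenvalue of the action
of `B` on the target. -/
def scalarHomological (ω : Fin p → ℝ) (c : ℂ) (H : W p s → ℂ) : W p s → ℂ := fun w =>
  fderiv ℝ H w (Bmap p ω w.1, 0, 0) - c * H w
    + w.2.1 • fderiv ℝ H w (((1 : ℝ), (0 : Fin p → ℂ)), 0, 0)

/-- The torus acts on `G` through the character `θ ↦ exp (i ∑ j, m j θ j)`. -/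
def HasTorusWeight (m : Fin p → ℤ) (G : W p s → ℂ) : Prop := ∀ θ x ν μ,
  G (torusAct p θ x, ν, μ) = Complex.exp (Complex.I * ∑ j, (m j : ℂ) * θ j) * G (x, ν, μ)

lemma hasDerivAt_comp_torusAct {H : W p s → ℂ} (hH : Differentiable ℝ H) (ω : Fin p → ℝ)
    (x : V p) (ν : ℝ) (μ : Fin s → ℝ) (t : ℝ) :
    HasDerivAt (fun t : ℝ => H (torusAct p (t • ω) x, ν, μ))
      (fderiv ℝ H (torusAct p (t • ω) x, ν, μ) (Bmap p ω (torusAct p (t • ω) x), 0, 0)) t :=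
  (hH _).hasFDerivAt.comp_hasDerivAt t
    ((hasDerivAt_torusAct p ω x t).prodMk (hasDerivAt_const t (ν, μ)))

lemma hasDerivAt_comp_translate {H : W p s → ℂ} (hH : Differentiable ℝ H)
    (a : ℝ) (z : Fin p → ℂ) (ν : ℝ) (μ : Fin s → ℝ) :
    HasDerivAt (fun t : ℝ => H ((t, z), ν, μ))
      (fderiv ℝ H ((a, z), ν, μ) (((1 : ℝ), (0 : Fin p → ℂ)), 0, 0)) a :=
  (hH _).hasFDerivAt.comp_hasDerivAt a
    (((hasDerivAt_id a).prodMk (hasDerivAt_const a z)).prodMk (hasDerivAt_const a (ν, μ)))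

lemma HasTorusWeight.fderiv_apply_Bmap {H : W p s → ℂ} {k : Fin p → ℤ} (hk : HasTorusWeight k H)
    (hH : Differentiable ℝ H) (ω : Fin p → ℝ) (w : W p s) :
    fderiv ℝ H w (Bmap p ω w.1, 0, 0) = (Complex.I * ∑ j, (k j : ℂ) * ω j) * H w := by
  obtain ⟨x, ν, μ⟩ := w
  have h₁ := hasDerivAt_comp_torusAct hH ω x ν μ 0
  rw [zero_smul, torusAct_zero] at h₁
  refine h₁.unique ?_
  have h₂ : HasDerivAt (fun t : ℝ => (t : ℂ) * (Complex.I * ∑ j, (k j : ℂ) * ω j))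
      (Complex.I * ∑ j, (k j : ℂ) * ω j) 0 := by
    simpa using ((hasDerivAt_id (0 : ℝ)).ofReal_comp).mul_const
      (Complex.I * ∑ j, (k j : ℂ) * ω j)
  have h₃ : (fun t : ℝ => H (torusAct p (t • ω) x, ν, μ)) = fun t : ℝ =>
      Complex.exp ((t : ℂ) * (Complex.I * ∑ j, (k j : ℂ) * ω j)) * H (x, ν, μ) := by
    funext t
    rw [hk, mul_left_comm (t : ℂ), Finset.mul_sum (a := (t : ℂ))]
    simp [mul_left_comm]
  rw [h₃]
  refine (h₂.cexp.mul_const (H (x, ν, μ))).congr_deriv ?_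
  simp

lemma eq_zero_of_eq_scalarHomological {G H : W p s → ℂ} {m : Fin p → ℤ} {ω : Fin p → ℝ}
    (hν : ∀ x ν ν' μ, G (x, ν, μ) = G (x, ν', μ)) (hG : HasTorusWeight m G)
    (hH : Differentiable ℝ H)
    (h : G = scalarHomological ω (Complex.I * ∑ j, (m j : ℂ) * ω j) H) : G = 0 := by
  funext ⟨x, ν, μ⟩
  rw [hν x ν 0 μ, Pi.zero_apply]
  set c : ℂ := Complex.I * ∑ j, (m j : ℂ) * ω j with hc
  have hc_re : c.re = 0 := by
    simp [hc]
  have hcurve : ∀ t : ℝ, HasDerivAt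
      (fun t : ℝ => Complex.exp (-(t * c)) * H (torusAct p (t • ω) x, 0, μ) - t * G (x, 0, μ))
      0 t := by
    intro t
    have h₁ : HasDerivAt (fun t : ℝ => -((t : ℂ) * c)) (-c) t := by
      exact ((((hasDerivAt_id t).ofReal_comp).mul_const c).neg).congr_deriv (by simp)
    have h₂ : HasDerivAt (fun t : ℝ => (t : ℂ) * G (x, 0, μ)) (G (x, 0, μ)) t := by
      simpa using ((hasDerivAt_id t).ofReal_comp).mul_const (G (x, 0, μ))
    refine ((h₁.cexp.mul (hasDerivAt_comp_torusAct hH ω x 0 μ t)).sub h₂).congr_deriv ?_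
    have h₃ := congrFun h (torusAct p (t • ω) x, 0, μ)
    rw [hG] at h₃
    have h₄ : Complex.I * ∑ j, (m j : ℂ) * ((t • ω) j : ℝ) = t * c := by
      rw [hc, mul_left_comm (t : ℂ), Finset.mul_sum (a := (t : ℂ))]
      simp [mul_left_comm]
    rw [h₄] at h₃
    simp only [scalarHomological, zero_smul, add_zero] at h₃
    have h₅ : Complex.exp (-(t * c)) * Complex.exp (t * c) = 1 := by
      rw [← Complex.exp_add]; simp
    linear_combination G (x, 0, μ) * h₅ - Complex.exp (-(t * c)) * h₃
  have hconst := is_const_of_deriv_eq_zero (fun t => (hcurve t).differentiableAt)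
    (fun t => (hcurve t).deriv)
  obtain ⟨C, hC⟩ := ((isCompact_closedBall (0 : V p) ‖x‖).image
    (by fun_prop : Continuous fun y : V p => (y, (0 : ℝ), μ))).exists_bound_of_continuousOn
    hH.continuous.continuousOn
  have hbound : ∀ t : ℝ, ‖H (torusAct p (t • ω) x, 0, μ)‖ ≤ C := fun t =>
    hC _ ⟨_, by simpa using norm_torusAct_le p (t • ω) x, rfl⟩
  by_contra hne
  have hpos : 0 < ‖G (x, 0, μ)‖ := norm_pos_iff.2 hne
  set t : ℝ := (2 * C + 1) / ‖G (x, 0, μ)‖ with ht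
  have htG : t * ‖G (x, 0, μ)‖ = 2 * C + 1 := div_mul_cancel₀ _ hpos.ne'
  have hC0 : 0 ≤ C := (norm_nonneg _).trans (hbound 0)
  have h₀ := hconst t 0
  simp only [zero_smul, torusAct_zero, Complex.ofReal_zero, zero_mul, neg_zero, Complex.exp_zero,
    one_mul, sub_zero] at h₀
  have h₁ : (t : ℂ) * G (x, 0, μ)
      = Complex.exp (-(t * c)) * H (torusAct p (t • ω) x, 0, μ) - H (x, 0, μ) := by
    linear_combination -h₀
  have h₂ : ‖Complex.exp (-(t * c))‖ = 1 := by
    simp [Complex.norm_exp, hc_re]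
  have h₃ : ‖(t : ℂ) * G (x, 0, μ)‖ ≤ C + C := by
    rw [h₁]
    refine (norm_sub_le _ _).trans (add_le_add ?_ ?_)
    · rw [norm_mul, h₂, one_mul]
      exact hbound t
    · simpa [torusAct_zero] using hbound 0
  rw [norm_mul, Complex.norm_real, Real.norm_of_nonneg (by positivity), htG] at h₃
  linarith

lemma IsHomogScalar.zero (n : ℕ) : IsHomogScalar p s n fun _ => 0 :=
  ⟨0, MvPolynomial.isHomogeneous_zero _ _ _, by simp⟩

lemma IsHomogScalar.const (a : ℝ) : IsHomogScalar p s 0 fun _ => a :=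
  ⟨MvPolynomial.C a, MvPolynomial.isHomogeneous_C _ _, by simp⟩

lemma IsHomogScalar.coord (i : HVar p s) : IsHomogScalar p s 1 fun w => coordsW w i :=
  ⟨MvPolynomial.X i, MvPolynomial.isHomogeneous_X _ _, by simp⟩

lemma IsHomogScalar.add {n : ℕ} {f g : W p s → ℝ} (hf : IsHomogScalar p s n f)
    (hg : IsHomogScalar p s n g) : IsHomogScalar p s n fun w => f w + g w := by
  obtain ⟨P, hP, hfP⟩ := hf
  obtain ⟨Q, hQ, hgQ⟩ := hg
  exact ⟨P + Q, hP.add hQ, fun w => by simp [hfP, hgQ]⟩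

lemma IsHomogScalar.mul {m n : ℕ} {f g : W p s → ℝ} (hf : IsHomogScalar p s m f)
    (hg : IsHomogScalar p s n g) : IsHomogScalar p s (m + n) fun w => f w * g w := by
  obtain ⟨P, hP, hfP⟩ := hf
  obtain ⟨Q, hQ, hgQ⟩ := hg
  exact ⟨P * Q, hP.mul hQ, fun w => by simp [hfP, hgQ]⟩

lemma IsHomogScalar.neg {n : ℕ} {f : W p s → ℝ} (hf : IsHomogScalar p s n f) :
    IsHomogScalar p s n fun w => -f w := by
  simpa using (IsHomogScalar.const (-1)).mul hf

lemma differentiable_coordsW (i : HVar p s) : Differentiable ℝ fun w : W p s => coordsW w i := by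
  rcases i with (_ | ⟨j, _ | _⟩) | (_ | k)
  · simp only [coordsW]; fun_prop
  · exact Complex.imCLM.differentiable.comp (by fun_prop : Differentiable ℝ fun w : W p s => w.1.2 j)
  · exact Complex.reCLM.differentiable.comp (by fun_prop : Differentiable ℝ fun w : W p s => w.1.2 j)
  · simp only [coordsW]; fun_prop
  · simp only [coordsW]; fun_prop

lemma IsHomogScalar.differentiable {n : ℕ} {f : W p s → ℝ} (hf : IsHomogScalar p s n f) :
    Differentiable ℝ f := by
  obtain ⟨P, -, hP⟩ := hf
  rw [funext hP]
  simp only [MvPolynomial.eval_eq']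
  refine Differentiable.fun_sum fun d _ => Differentiable.const_mul (fun w => ?_) _
  exact (HasFDerivAt.finsetProd fun i _ =>
    ((differentiable_coordsW i w).fun_pow (d i)).hasFDerivAt).differentiableAt

/-- Complex-valued homogeneous polynomial functions of degree `n` in the real coordinates. -/
def homogComplex (p s n : ℕ) : Submodule ℂ (W p s → ℂ) where
  carrier := {F | IsHomogScalar p s n (fun w => (F w).re) ∧ IsHomogScalar p s n fun w => (F w).im}
  zero_mem' := ⟨IsHomogScalar.zero n, IsHomogScalar.zero n⟩
  add_mem' hF hG := ⟨hF.1.add hG.1, hF.2.add hG.2⟩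
  smul_mem' c F hF := by
    have h (a b : ℝ) : IsHomogScalar p s n fun w => a * (F w).re + b * (F w).im := by
      simpa using ((IsHomogScalar.const a).mul hF.1).add ((IsHomogScalar.const b).mul hF.2)
    constructor
    · simpa [sub_eq_add_neg] using h c.re (-c.im)
    · simpa [add_comm] using h c.im c.re

instance : SetLike.GradedMonoid (homogComplex p s) where
  one_mem := ⟨by simpa using IsHomogScalar.const 1, by simpa using IsHomogScalar.zero 0⟩
  mul_mem _ _ _ _ hF hG :=
    ⟨by simpa [sub_eq_add_neg] using (hF.1.mul hG.1).add (hF.2.mul hG.2).neg,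
      by simpa using (hF.1.mul hG.2).add (hF.2.mul hG.1)⟩

lemma differentiable_of_mem_homogComplex {n : ℕ} {F : W p s → ℂ} (hF : F ∈ homogComplex p s n) :
    Differentiable ℝ F := by
  have h : F = fun w => ((F w).re : ℂ) + ((F w).im : ℂ) * Complex.I := by simp
  rw [h]
  exact (Complex.ofRealCLM.differentiable.comp hF.1.differentiable).add
    ((Complex.ofRealCLM.differentiable.comp hF.2.differentiable).mul_const _)

/-- The coordinates `x₀, z j, conj (z j), ν, μ k` on the complexification. -/
def complexCoord : HVar p s → W p s → ℂ
  | .inl (.inl _), w => w.1.1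
  | .inl (.inr (j, true)), w => w.1.2 j
  | .inl (.inr (j, false)), w => starRingEnd ℂ (w.1.2 j)
  | .inr (.inl _), w => w.2.1
  | .inr (.inr k), w => w.2.2 k

lemma complexCoord_mem_homogComplex (i : HVar p s) : complexCoord i ∈ homogComplex p s 1 := by
  rcases i with (u | ⟨j, _ | _⟩) | (u | k)
  · exact ⟨.coord (.inl (.inl u)), .zero 1⟩
  · exact ⟨.coord (.inl (.inr (j, true))), (IsHomogScalar.coord (.inl (.inr (j, false)))).neg⟩
  · exact ⟨.coord (.inl (.inr (j, true))), .coord (.inl (.inr (j, false)))⟩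
  · exact ⟨.coord (.inr (.inl u)), .zero 1⟩
  · exact ⟨.coord (.inr (.inr k)), .zero 1⟩

/-- The monomial with exponent `e` in the coordinates `complexCoord`. -/
def complexMonomial (e : HVar p s → ℕ) : W p s → ℂ := ∏ i, complexCoord i ^ e i

/-- The span of the monomials of degree `n` in the coordinates `complexCoord`. -/
def complexMonomialSpan (p s n : ℕ) : Submodule ℂ (W p s → ℂ) :=
  Submodule.span ℂ (complexMonomial '' {e | ∑ i, e i = n})

instance : SetLike.GradedMonoid (complexMonomialSpan p s) where
  one_mem := Submodule.subset_span ⟨0, by simp, by simp [complexMonomial]⟩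
  mul_mem m n F G hF hG := by
    have h := Submodule.mul_mem_mul hF hG
    rw [complexMonomialSpan, complexMonomialSpan, Submodule.span_mul_span] at h
    refine Submodule.span_mono ?_ h
    rintro _ ⟨_, ⟨d, hd, rfl⟩, _, ⟨e, he, rfl⟩, rfl⟩
    refine ⟨d + e, ?_, ?_⟩
    · simp_all only [Set.mem_ofPred_eq, Pi.add_apply, Finset.sum_add_distrib]
    · simp [complexMonomial, pow_add, Finset.prod_mul_distrib]

lemma complexCoord_mem_complexMonomialSpan (i : HVar p s) :
    complexCoord i ∈ complexMonomialSpan p s 1 := by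
  classical
  refine Submodule.subset_span ⟨Pi.single i 1, Finset.sum_pi_single' i 1 _ |>.trans (by simp), ?_⟩
  rw [complexMonomial, Finset.prod_eq_single i] <;> simp +contextual

lemma ofReal_coordsW_mem_complexMonomialSpan (i : HVar p s) :
    (fun w => (coordsW w i : ℂ)) ∈ complexMonomialSpan p s 1 := by
  rcases i with (u | ⟨j, _ | _⟩) | (u | k)
  · exact complexCoord_mem_complexMonomialSpan (.inl (.inl u))
  · convert (complexMonomialSpan p s 1).smul_mem (2 * Complex.I)⁻¹ (sub_mem
      (complexCoord_mem_complexMonomialSpan (.inl (.inr (j, true))))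
      (complexCoord_mem_complexMonomialSpan (.inl (.inr (j, false))))) using 1
    funext w
    simp only [coordsW, complexCoord, Pi.smul_apply, Pi.sub_apply, Complex.sub_conj, smul_eq_mul]
    field_simp
    simp [mul_comm]
  · convert (complexMonomialSpan p s 1).smul_mem (2 : ℂ)⁻¹ (add_mem
      (complexCoord_mem_complexMonomialSpan (.inl (.inr (j, true))))
      (complexCoord_mem_complexMonomialSpan (.inl (.inr (j, false))))) using 1
    funext w
    simp [coordsW, complexCoord, Complex.add_conj]
  · exact complexCoord_mem_complexMonomialSpan (.inr (.inl u))
  · exact complexCoord_mem_complexMonomialSpan (.inr (.inr k))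

lemma prod_pow_mem_of_gradedMonoid {A : ℕ → Submodule ℂ (W p s → ℂ)} [SetLike.GradedMonoid A]
    {ι : Type*} [Fintype ι] {F : ι → W p s → ℂ} (hF : ∀ i, F i ∈ A 1) (e : ι → ℕ) :
    ∏ i, F i ^ e i ∈ A (∑ i, e i) :=
  SetLike.prod_mem_graded A e _ fun i _ => by simpa using SetLike.pow_mem_graded (e i) (hF i)

lemma IsHomogScalar.ofReal_mem_complexMonomialSpan {n : ℕ} {f : W p s → ℝ}
    (hf : IsHomogScalar p s n f) : (fun w => (f w : ℂ)) ∈ complexMonomialSpan p s n := by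
  obtain ⟨P, hP, hfP⟩ := hf
  have h : (fun w => (f w : ℂ)) = ∑ d ∈ P.support,
      ((P.coeff d : ℝ) : ℂ) • ∏ i, (fun w : W p s => (coordsW w i : ℂ)) ^ d i := by
    funext w
    simp [hfP, MvPolynomial.eval_eq', -Fintype.prod_sum_type]
  rw [h]
  refine sum_mem fun d hd => Submodule.smul_mem _ _ ?_
  have hdeg : ∑ i, d i = n := by
    rw [← Finsupp.degree_eq_sum, Finsupp.degree_eq_weight_one]
    exact hP (MvPolynomial.mem_support_iff.1 hd)
  rw [← hdeg]
  exact prod_pow_mem_of_gradedMonoid ofReal_coordsW_mem_complexMonomialSpan d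

lemma homogComplex_le_complexMonomialSpan (n : ℕ) :
    homogComplex p s n ≤ complexMonomialSpan p s n := by
  intro F hF
  have h : F = (fun w => ((F w).re : ℂ)) + Complex.I • fun w => ((F w).im : ℂ) := by
    funext w
    simp [mul_comm Complex.I]
  rw [h]
  exact add_mem hF.1.ofReal_mem_complexMonomialSpan
    (Submodule.smul_mem _ _ hF.2.ofReal_mem_complexMonomialSpan)

lemma scalarHomological_add (ω : Fin p → ℝ) (c : ℂ) {F G : W p s → ℂ} (hF : Differentiable ℝ F)
    (hG : Differentiable ℝ G) : scalarHomological ω c (F + G) =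
      scalarHomological ω c F + scalarHomological ω c G := by
  funext w
  simp only [scalarHomological, Pi.add_apply, fderiv_add (hF w) (hG w), _root_.add_apply,
    smul_add]
  ring

lemma scalarHomological_smul (ω : Fin p → ℝ) (c a : ℂ) {F : W p s → ℂ}
    (hF : Differentiable ℝ F) :
    scalarHomological ω c (a • F) = a • scalarHomological ω c F := by
  funext w
  simp only [scalarHomological, Pi.smul_apply, fderiv_const_smul (hF w), _root_.smul_apply,
    smul_eq_mul, Complex.real_smul]
  ring

/-- The sums of a `ν`-independent polynomial of torus weight `m` and of an element of the range of
the homological operator. -/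
def decomposable (ω : Fin p → ℝ) (m : Fin p → ℤ) (s n : ℕ) : Submodule ℂ (W p s → ℂ) where
  carrier := {F | ∃ G ∈ homogComplex p s n, ∃ H ∈ homogComplex p s n,
    (∀ x ν ν' μ, G (x, ν, μ) = G (x, ν', μ)) ∧ HasTorusWeight m G ∧
    F = G + scalarHomological ω (Complex.I * ∑ j, (m j : ℂ) * ω j) H}
  zero_mem' := ⟨0, zero_mem _, 0, zero_mem _, fun _ _ _ _ => rfl, fun _ _ _ _ => by simp, by
    funext w
    simp [scalarHomological]⟩
  add_mem' := by
    rintro _ _ ⟨G, hG, H, hH, hν, hm, rfl⟩ ⟨G', hG', H', hH', hν', hm', rfl⟩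
    refine ⟨G + G', add_mem hG hG', H + H', add_mem hH hH', fun x ν₁ ν₂ μ => ?_,
      fun θ x ν μ => ?_, ?_⟩
    · simp [hν x ν₁ ν₂, hν' x ν₁ ν₂]
    · simp [hm θ x, hm' θ x, mul_add]
    · rw [scalarHomological_add _ _ (differentiable_of_mem_homogComplex hH)
        (differentiable_of_mem_homogComplex hH')]
      abel
  smul_mem' := by
    rintro a _ ⟨G, hG, H, hH, hν, hm, rfl⟩
    refine ⟨a • G, Submodule.smul_mem _ _ hG, a • H, Submodule.smul_mem _ _ hH,
      fun x ν₁ ν₂ μ => ?_, fun θ x ν μ => ?_, ?_⟩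
    · simp [hν x ν₁ ν₂]
    · simp [hm θ x, mul_left_comm]
    · rw [scalarHomological_smul _ _ _ (differentiable_of_mem_homogComplex hH), smul_add]

lemma scalarHomological_mem_decomposable {ω : Fin p → ℝ} {m : Fin p → ℤ} {n : ℕ} {H : W p s → ℂ}
    (hH : H ∈ homogComplex p s n) :
    scalarHomological ω (Complex.I * ∑ j, (m j : ℂ) * ω j) H ∈ decomposable ω m s n :=
  ⟨0, zero_mem _, H, hH, fun _ _ _ _ => rfl, fun _ _ _ _ => by simp, by simp⟩

lemma scalarHomological_monomial {ω : Fin p → ℝ} {k : Fin p → ℤ} {R : W p s → ℂ}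
    (hdiff : Differentiable ℝ R) (hk : HasTorusWeight k R)
    (hR : ∀ a a' z ν ν' μ, R ((a, z), ν, μ) = R ((a', z), ν', μ)) (c : ℂ) (a n : ℕ) (w : W p s) :
    scalarHomological ω c (fun w => (w.1.1 : ℂ) ^ a * (w.2.1 : ℂ) ^ n * R w) w =
      (Complex.I * (∑ j, (k j : ℂ) * ω j) - c) * ((w.1.1 : ℂ) ^ a * (w.2.1 : ℂ) ^ n * R w)
        + a * ((w.1.1 : ℂ) ^ (a - 1) * (w.2.1 : ℂ) ^ (n + 1) * R w) := by
  obtain ⟨⟨y, z⟩, ν, μ⟩ := w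
  have hx : Differentiable ℝ fun w : W p s => (w.1.1 : ℂ) :=
    Complex.ofRealCLM.differentiable.comp (by fun_prop : Differentiable ℝ fun w : W p s => w.1.1)
  have hν : Differentiable ℝ fun w : W p s => (w.2.1 : ℂ) :=
    Complex.ofRealCLM.differentiable.comp (by fun_prop : Differentiable ℝ fun w : W p s => w.2.1)
  have hM : Differentiable ℝ fun w : W p s => (w.1.1 : ℂ) ^ a * (w.2.1 : ℂ) ^ n * R w :=
    ((hx.pow a).mul (hν.pow n)).mul hdiff
  have hkM : HasTorusWeight k fun w : W p s => (w.1.1 : ℂ) ^ a * (w.2.1 : ℂ) ^ n * R w := by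
    intro θ x ν μ
    simp only [hk θ x, show (torusAct p θ x).1 = x.1 from rfl]
    ring
  have h₁ : HasDerivAt (fun t : ℝ => (t : ℂ) ^ a * (ν : ℂ) ^ n * R ((y, z), ν, μ))
      (a * (y : ℂ) ^ (a - 1) * (ν : ℂ) ^ n * R ((y, z), ν, μ)) y := by
    refine ((((hasDerivAt_id y).ofReal_comp.fun_pow a).mul_const _).mul_const _).congr_deriv ?_
    simp
  have h₂ := hasDerivAt_comp_translate hM y z ν μ
  have h₃ : (fun t : ℝ => (t : ℂ) ^ a * (ν : ℂ) ^ n * R ((t, z), ν, μ)) =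
      fun t : ℝ => (t : ℂ) ^ a * (ν : ℂ) ^ n * R ((y, z), ν, μ) :=
    funext fun t => by rw [hR t y z ν ν μ]
  simp only [h₃] at h₂
  simp only [scalarHomological, hkM.fderiv_apply_Bmap hM, h₂.unique h₁, Complex.real_smul]
  ring

lemma eq_of_sum_intCast_mul_eq {ω : Fin p → ℝ}
    (hind : ∀ r : Fin p → ℚ, (∑ j, (r j : ℝ) * ω j) = 0 → ∀ j, r j = 0) {k m : Fin p → ℤ}
    (h : ∑ j, (k j : ℂ) * ω j = ∑ j, (m j : ℂ) * ω j) : k = m := by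
  have h' : ∑ j, (k j : ℝ) * ω j = ∑ j, (m j : ℝ) * ω j := by exact_mod_cast h
  funext j
  have := hind (fun j => (k j - m j : ℤ)) (by simp [sub_mul, h']) j
  exact sub_eq_zero.1 (by exact_mod_cast this)

lemma mem_decomposable_of_monomial {ω : Fin p → ℝ}
    (hind : ∀ r : Fin p → ℚ, (∑ j, (r j : ℝ) * ω j) = 0 → ∀ j, r j = 0) (m : Fin p → ℤ)
    {k : Fin p → ℤ} {r : ℕ} {R : W p s → ℂ} (hmem : R ∈ homogComplex p s r)
    (hk : HasTorusWeight k R)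
    (hR : ∀ a a' z ν ν' μ, R ((a, z), ν, μ) = R ((a', z), ν', μ)) (a n : ℕ) :
    (fun w => (w.1.1 : ℂ) ^ a * (w.2.1 : ℂ) ^ n * R w) ∈ decomposable ω m s (a + n + r) := by
  have hdiff := differentiable_of_mem_homogComplex hmem
  have hmon (a n : ℕ) :
      (fun w => (w.1.1 : ℂ) ^ a * (w.2.1 : ℂ) ^ n * R w) ∈ homogComplex p s (a + n + r) := by
    have hx := SetLike.pow_mem_graded a
      (complexCoord_mem_homogComplex (p := p) (s := s) (.inl (.inl ())))
    have hν := SetLike.pow_mem_graded n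
      (complexCoord_mem_homogComplex (p := p) (s := s) (.inr (.inl ())))
    simpa using! SetLike.mul_mem_graded (SetLike.mul_mem_graded hx hν) hmem
  by_cases hkm : k = m
  · subst hkm
    rcases n with _ | n
    · refine ⟨_, hmon a 0, 0, zero_mem _, fun x ν ν' μ => ?_, fun θ x ν μ => ?_, ?_⟩
      · simp [hR x.1 x.1 x.2 ν ν' μ]
      · simp only [hk θ x, show (torusAct p θ x).1 = x.1 from rfl]
        ring
      · funext w
        simp [scalarHomological]
    · have h := Submodule.smul_mem _ ((a + 1 : ℂ)⁻¹)
        (scalarHomological_mem_decomposable (ω := ω) (m := k) (hmon (a + 1) n))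
      rw [show a + (n + 1) + r = a + 1 + n + r by ring]
      convert h using 1
      funext w
      have ha : (a + 1 : ℂ) ≠ 0 := by exact_mod_cast a.succ_ne_zero
      rw [Pi.smul_apply, scalarHomological_monomial hdiff hk hR]
      simp only [sub_self, zero_mul, zero_add, smul_eq_mul, Nat.add_sub_cancel, Nat.cast_add,
        Nat.cast_one]
      field_simp
  · set lam : ℂ := Complex.I * (∑ j, (k j : ℂ) * ω j) - Complex.I * ∑ j, (m j : ℂ) * ω j with hlam
    have hlam0 : lam ≠ 0 := fun h => hkm <| eq_of_sum_intCast_mul_eq hind <|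
      mul_left_cancel₀ Complex.I_ne_zero (sub_eq_zero.1 h)
    induction a generalizing n with
    | zero =>
      have h := Submodule.smul_mem _ lam⁻¹
        (scalarHomological_mem_decomposable (ω := ω) (m := m) (hmon 0 n))
      convert h using 1
      funext w
      rw [Pi.smul_apply, scalarHomological_monomial hdiff hk hR, ← hlam]
      simp [hlam0]
    | succ a ih =>
      have h := Submodule.smul_mem _ lam⁻¹
        (scalarHomological_mem_decomposable (ω := ω) (m := m) (hmon (a + 1) n))
      have h' := Submodule.smul_mem _ (lam⁻¹ * (a + 1)) (ih (n + 1))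
      rw [show a + (n + 1) + r = a + 1 + n + r by ring] at h'
      convert sub_mem h h' using 1
      funext w
      rw [Pi.sub_apply, Pi.smul_apply, scalarHomological_monomial hdiff hk hR, ← hlam]
      simp only [Pi.smul_apply, smul_eq_mul, Nat.add_sub_cancel, Nat.cast_add, Nat.cast_one]
      field_simp
      ring

/-- The torus weight of the coordinate `complexCoord i`. -/
def coordWeight : HVar p s → Fin p → ℤ
  | .inl (.inr (j, true)) => Pi.single j 1
  | .inl (.inr (j, false)) => Pi.single j (-1)
  | _ => 0

lemma hasTorusWeight_complexCoord (i : HVar p s) :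
    HasTorusWeight (coordWeight i) (complexCoord i) := by
  intro θ x ν μ
  rcases i with (u | ⟨j, _ | _⟩) | (u | k)
  · simp [coordWeight, complexCoord, torusAct]
  · simp [coordWeight, complexCoord, torusAct, Pi.single_apply, ← Complex.exp_conj]
  · simp [coordWeight, complexCoord, torusAct, Pi.single_apply]
  · simp [coordWeight, complexCoord]
  · simp [coordWeight, complexCoord]

lemma HasTorusWeight.mul {k m : Fin p → ℤ} {F G : W p s → ℂ} (hF : HasTorusWeight k F)
    (hG : HasTorusWeight m G) : HasTorusWeight (k + m) (F * G) := by
  intro θ x ν μ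
  simp only [Pi.mul_apply, hF θ x, hG θ x, Pi.add_apply, Int.cast_add, add_mul,
    Finset.sum_add_distrib, mul_add, Complex.exp_add]
  ring

lemma hasTorusWeight_one : HasTorusWeight 0 (1 : W p s → ℂ) := fun _ _ _ _ => by simp

lemma HasTorusWeight.pow {k : Fin p → ℤ} {F : W p s → ℂ} (hF : HasTorusWeight k F) (n : ℕ) :
    HasTorusWeight (n • k) (F ^ n) := by
  induction n with
  | zero => simpa using hasTorusWeight_one
  | succ n ih => simpa only [pow_succ, succ_nsmul] using ih.mul hF

lemma HasTorusWeight.prod {ι : Type*} (t : Finset ι) {k : ι → Fin p → ℤ} {F : ι → W p s → ℂ}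
    (hF : ∀ i, HasTorusWeight (k i) (F i)) : HasTorusWeight (∑ i ∈ t, k i) (∏ i ∈ t, F i) := by
  classical
  induction t using Finset.induction_on with
  | empty => simpa using hasTorusWeight_one
  | insert i t hi ih =>
    rw [Finset.sum_insert hi, Finset.prod_insert hi]
    exact (hF i).mul ih

lemma complexMonomial_mem_decomposable {ω : Fin p → ℝ}
    (hind : ∀ r : Fin p → ℚ, (∑ j, (r j : ℝ) * ω j) = 0 → ∀ j, r j = 0) (m : Fin p → ℤ)
    (e : HVar p s → ℕ) : complexMonomial e ∈ decomposable ω m s (∑ i, e i) := by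
  have hz := prod_pow_mem_of_gradedMonoid (A := homogComplex p s)
    (fun q : Fin p × Bool => complexCoord_mem_homogComplex (.inl (.inr q)))
    fun q => e (.inl (.inr q))
  have hμ := prod_pow_mem_of_gradedMonoid (A := homogComplex p s)
    (fun k : Fin s => complexCoord_mem_homogComplex (.inr (.inr k)))
    fun k => e (.inr (.inr k))
  have hwz := HasTorusWeight.prod (p := p) (s := s) Finset.univ fun q : Fin p × Bool =>
    (hasTorusWeight_complexCoord (.inl (.inr q))).pow (e (.inl (.inr q)))
  have hwμ := HasTorusWeight.prod (p := p) (s := s) Finset.univ fun k : Fin s =>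
    (hasTorusWeight_complexCoord (.inr (.inr k))).pow (e (.inr (.inr k)))
  convert mem_decomposable_of_monomial hind m (SetLike.mul_mem_graded hz hμ) (hwz.mul hwμ) ?_
    (e (.inl (.inl ()))) (e (.inr (.inl ()))) using 1
  · simp only [Fintype.sum_sum_type, Finset.univ_unique, Finset.sum_singleton]
    congr 1
    simp only [PUnit.default_eq_unit]
    ring
  · funext w
    simp only [complexMonomial, Fintype.prod_sum_type, Finset.univ_unique, Finset.prod_singleton,
      Pi.mul_apply, Pi.pow_apply, PUnit.default_eq_unit]
    simp only [complexCoord]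
    ring
  · intro a a' z ν ν' μ
    simp only [Pi.mul_apply, Finset.prod_apply, Pi.pow_apply]
    congr 1
    refine Finset.prod_congr rfl fun q _ => ?_
    rcases q with ⟨j, _ | _⟩ <;> rfl

lemma homogComplex_le_decomposable {ω : Fin p → ℝ}
    (hind : ∀ r : Fin p → ℚ, (∑ j, (r j : ℝ) * ω j) = 0 → ∀ j, r j = 0) (m : Fin p → ℤ) (n : ℕ) :
    homogComplex p s n ≤ decomposable ω m s n := by
  refine (homogComplex_le_complexMonomialSpan n).trans (Submodule.span_le.2 ?_)
  rintro _ ⟨e, rfl, rfl⟩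
  exact complexMonomial_mem_decomposable hind m e

lemma map_Lop {ω : Fin p → ℝ} {h : W p s → V p} (hh : Differentiable ℝ h) {c : ℂ}
    (L : V p →L[ℝ] ℂ) (hL : ∀ v, L (Bmap p ω v) = c * L v) :
    (fun w => L (Lop p s ω h w)) = scalarHomological ω c fun w => L (h w) := by
  funext w
  have hw : fderiv ℝ (fun w => L (h w)) w = L ∘L fderiv ℝ h w :=
    (L.hasFDerivAt.comp w (hh w).hasFDerivAt).fderiv
  simp only [scalarHomological, hw, ContinuousLinearMap.comp_apply, Lop, map_add, map_sub, map_smul,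
    hL]

lemma scalarHomological_zero_comp {ω : Fin p → ℝ} {H : W p s → ℂ} (hH : Differentiable ℝ H)
    (L : ℂ →L[ℝ] ℂ) (w : W p s) :
    scalarHomological ω 0 (fun w => L (H w)) w = L (scalarHomological ω 0 H w) := by
  have hw : fderiv ℝ (fun w => L (H w)) w = L ∘L fderiv ℝ H w :=
    (L.hasFDerivAt.comp w (hH w).hasFDerivAt).fderiv
  simp only [scalarHomological, hw, ContinuousLinearMap.comp_apply, zero_mul, sub_zero, map_add,
    map_smul]

lemma ofReal_fst_Lop {ω : Fin p → ℝ} {h : W p s → V p} (hh : Differentiable ℝ h) :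
    (fun w => ((Lop p s ω h w).1 : ℂ)) = scalarHomological ω 0 fun w => ((h w).1 : ℂ) :=
  map_Lop hh (Complex.ofRealCLM ∘L ContinuousLinearMap.fst ℝ ℝ (Fin p → ℂ))
    fun v => by simp [Bmap]

lemma snd_Lop {ω : Fin p → ℝ} {h : W p s → V p} (hh : Differentiable ℝ h) (j : Fin p) :
    (fun w => (Lop p s ω h w).2 j) =
      scalarHomological ω (Complex.I * ω j) fun w => (h w).2 j :=
  map_Lop hh (ContinuousLinearMap.proj (R := ℝ) (φ := fun _ : Fin p => ℂ) j ∘L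
    ContinuousLinearMap.snd ℝ ℝ (Fin p → ℂ))
    fun v => by simp [Bmap]

lemma sum_single_intCast_mul (j : Fin p) (θ : Fin p → ℝ) :
    ∑ i, ((Pi.single j 1 : Fin p → ℤ) i : ℂ) * θ i = θ j := by
  simp [Pi.single_apply]

lemma MemH.ofReal_fst_mem {n : ℕ} {f : W p s → V p} (hf : MemH p s n f) :
    (fun w => ((f w).1 : ℂ)) ∈ homogComplex p s n :=
  ⟨hf.1, IsHomogScalar.zero n⟩

lemma MemH.differentiable {n : ℕ} {f : W p s → V p} (hf : MemH p s n f) : Differentiable ℝ f :=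
  hf.1.differentiable.prodMk <| differentiable_pi.2 fun j =>
    differentiable_of_mem_homogComplex (hf.2 j)

lemma Lop_sub {ω : Fin p → ℝ} {h h' : W p s → V p} (hh : Differentiable ℝ h)
    (hh' : Differentiable ℝ h') : Lop p s ω (h - h') = Lop p s ω h - Lop p s ω h' := by
  funext w
  have hB : Bmap p ω (h w - h' w) = Bmap p ω (h w) - Bmap p ω (h' w) := by
    ext <;> simp [Bmap, mul_sub]
  simp only [Lop, Pi.sub_apply, fderiv_sub (hh w) (hh' w), _root_.sub_apply, hB, smul_sub]
  abel

/-- A `ν`-independent equivariant map in the range of the homological operator vanishes. -/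
lemma eq_zero_of_eq_Lop {ω : Fin p → ℝ} {g h : W p s → V p} (hν : NuIndep p s g)
    (hg : Equivar p s g) (hh : Differentiable ℝ h) (hgh : g = Lop p s ω h) : g = 0 := by
  have h₀ := eq_zero_of_eq_scalarHomological (G := fun w => ((g w).1 : ℂ))
    (H := fun w => ((h w).1 : ℂ)) (m := 0) (ω := ω) (fun x ν ν' μ => by simp only [hν x ν ν'])
    (fun θ x ν μ => by simp only [hg θ x]; simp [torusAct])
    (Complex.ofRealCLM.differentiable.comp hh.fst) (by rw [hgh, ofReal_fst_Lop hh]; simp)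
  have h₁ (j : Fin p) := eq_zero_of_eq_scalarHomological (G := fun w => (g w).2 j)
    (H := fun w => (h w).2 j) (m := Pi.single j 1) (ω := ω)
    (fun x ν ν' μ => by simp only [hν x ν ν'])
    (fun θ x ν μ => by simp only [sum_single_intCast_mul, hg θ x]; rfl)
    (differentiable_pi.1 hh.snd j) (by rw [hgh, snd_Lop hh, sum_single_intCast_mul])
  funext w
  exact Prod.ext (Complex.ofReal_injective (congrFun h₀ w)) (funext fun j => congrFun (h₁ j) w)

lemma exists_equivariant_add_Lop {ω : Fin p → ℝ}
    (hind : ∀ r : Fin p → ℚ, (∑ j, (r j : ℝ) * ω j) = 0 → ∀ j, r j = 0) {n : ℕ}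
    {f : W p s → V p} (hf : MemH p s n f) :
    ∃ g, (MemH p s n g ∧ NuIndep p s g ∧ Equivar p s g) ∧
      ∃ h, MemH p s n h ∧ f = g + Lop p s ω h := by
  obtain ⟨G, hG, H, hH, hGν, hGθ, hGH⟩ := homogComplex_le_decomposable hind 0 n hf.ofReal_fst_mem
  choose G' hG' H' hH' hGν' hGθ' hGH' using fun j =>
    homogComplex_le_decomposable (s := s) hind (Pi.single j 1) n (hf.2 j)
  simp only [sum_single_intCast_mul, HasTorusWeight] at hGθ' hGH'
  simp only [HasTorusWeight, Pi.zero_apply, Int.cast_zero, zero_mul, Finset.sum_const_zero,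
    mul_zero, Complex.exp_zero, one_mul] at hGθ hGH
  have hh : MemH p s n fun w => ((H w).re, fun j => H' j w) := ⟨hH.1, hH'⟩
  refine ⟨fun w => ((G w).re, fun j => G' j w), ⟨⟨hG.1, hG'⟩, fun x ν ν' μ => ?_,
    fun θ x ν μ => ?_⟩, _, hh, ?_⟩
  · simp only [hGν x ν ν' μ, hGν' _ x ν ν' μ]
  · simp only [hGθ, hGθ']
    rfl
  · funext w
    refine Prod.ext ?_ (funext fun j => ?_)
    · have h₁ := congrFun (ofReal_fst_Lop (ω := ω) hh.differentiable) w
      have h₂ := scalarHomological_zero_comp (ω := ω) (differentiable_of_mem_homogComplex hH)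
        (Complex.ofRealCLM ∘L Complex.reCLM) w
      have h₃ := congrArg Complex.re (h₁.trans h₂)
      have h₄ := congrArg Complex.re (congrFun hGH w)
      simp only [ContinuousLinearMap.comp_apply, Complex.ofRealCLM_apply, Complex.reCLM_apply,
        Complex.ofReal_re, Pi.add_apply, Complex.add_re] at h₃ h₄
      rw [h₄, ← h₃]
      rfl
    · have h₁ := congrFun (snd_Lop (ω := ω) hh.differentiable j) w
      have h₂ := congrFun (hGH' j) w
      exact h₂.trans (congrArg (G' j w + ·) h₁.symm)

end

/-- `H^{2p+2+s}_ℓ(ℝ^{2p+1}) = H^{2p+1+s}_ℓ(ℝ^{2p+1}, T^p) ⊕ range L_{B,ν}`: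
every homogeneous degree-ℓ polynomial map decomposes uniquely as the sum of a ν-independent
`T^p`-equivariant polynomial map and an element of the range of the homological operator. -/
theorem directSum_equivariant_range_homological
    (p s ℓ : ℕ) (hp : 1 ≤ p) (hℓ : 2 ≤ ℓ)
    (ω : Fin p → ℝ) (hω : ∀ j, 0 < ω j)
    (hind : ∀ r : Fin p → ℚ, (∑ j, (r j : ℝ) * ω j) = 0 → ∀ j, r j = 0)
    (f : W p s → V p) (hf : MemH p s ℓ f) :
    ∃! gk : (W p s → V p) × (W p s → V p),
      (MemH p s ℓ gk.1 ∧ NuIndep p s gk.1 ∧ Equivar p s gk.1) ∧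
      (∃ h, MemH p s ℓ h ∧ gk.2 = Lop p s ω h) ∧
      f = fun w => gk.1 w + gk.2 w := by
  obtain ⟨g, hg, h, hh, rfl⟩ := exists_equivariant_add_Lop hind hf
  refine ⟨(g, Lop p s ω h), ⟨hg, ⟨h, hh, rfl⟩, rfl⟩, ?_⟩
  rintro ⟨g', k'⟩ ⟨⟨hg', hν', he'⟩, ⟨h', hh', rfl⟩, heq⟩
  dsimp only at hν' he'
  replace heq : g + Lop p s ω h = g' + Lop p s ω h' := heq
  have hsub : g' - g = 0 := by
    refine eq_zero_of_eq_Lop (ω := ω) (h := h - h') (fun x ν₁ ν₂ μ => ?_) (fun θ x ν μ => ?_)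
      (hh.differentiable.sub hh'.differentiable) ?_
    · rw [Pi.sub_apply, Pi.sub_apply, hν' x ν₁ ν₂, hg.2.1 x ν₁ ν₂]
    · rw [Pi.sub_apply, Pi.sub_apply, he' θ x, hg.2.2 θ x]
      ext <;> simp [torusAct, mul_sub]
    · rw [Lop_sub hh.differentiable hh'.differentiable, sub_eq_sub_iff_add_eq_add, ← heq, add_comm]
  obtain rfl : g' = g := sub_eq_zero.1 hsub
  rw [add_left_cancel heq]

end
end

section
/- Fix τ = (τ_1, …, τ_{p+1}) ∈ ℝ^{p+1}, u_0 ∈ ℝ and u_1, …, u_p ∈ ℂ. If the semisimple-case map Π ∘ A ∘ E^ℓ_τ : H^{p+1+s}_ℓ(ℝ) → H^{p+1+s}_ℓ(ℝ^{p+1}, Z_{2,p}) is surjective, then the non-semisimple map Π ∘ Å ∘ E̊^ℓ_τ : H^{2p+2+s}_ℓ(ℝ) → H^{p+1+s}_ℓ(ℝ^{p+1}, Z_{2,p}) is also surjective. -/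
noncomputable section

/-! Definitions for the delay-evaluation operators `E̊^ℓ_τ`, `E^ℓ_τ` and the
restriction map `ℛ`. -/

/-- Index type for the `2p+2` real variables `(v_k, w_k)` and the `s` parameters. -/
abbrev EVar (p s : ℕ) := (Fin (p + 1) × Bool) ⊕ Fin s

/-- Domain of scalar polynomials in `H^{2p+2+s}_ℓ(ℝ)`: variables `(v, w, μ)`. -/
abbrev DE (p s : ℕ) := (Fin (p + 1) → ℝ) × (Fin (p + 1) → ℝ) × (Fin s → ℝ)

def coordsE {p s : ℕ} (d : DE p s) : EVar p s → ℝ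
  | .inl (k, b) => if b then d.1 k else d.2.1 k
  | .inr j => d.2.2 j

/-- Membership in `H^{2p+2+s}_ℓ(ℝ)`. -/
def IsHomogE (p s ℓ : ℕ) (h : DE p s → ℝ) : Prop :=
  ∃ P : MvPolynomial (EVar p s) ℝ, P.IsHomogeneous ℓ ∧
    ∀ d, h d = MvPolynomial.eval (coordsE d) P

/-- Domain of scalar polynomials in `H^{p+1+s}_ℓ(ℝ)`: variables `(v, μ)`. -/
abbrev DS (p s : ℕ) := (Fin (p + 1) → ℝ) × (Fin s → ℝ)

def coordsS {p s : ℕ} (d : DS p s) : Fin (p + 1) ⊕ Fin s → ℝ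
  | .inl k => d.1 k
  | .inr j => d.2 j

/-- Membership in `H^{p+1+s}_ℓ(ℝ)`. -/
def IsHomogS (p s ℓ : ℕ) (h : DS p s → ℝ) : Prop :=
  ∃ P : MvPolynomial (Fin (p + 1) ⊕ Fin s) ℝ, P.IsHomogeneous ℓ ∧
    ∀ d, h d = MvPolynomial.eval (coordsS d) P

/-- The restriction map `ℛ : H^{2p+2+s}_ℓ(ℝ) → H^{p+1+s}_ℓ(ℝ)`,
`(ℛh)(v, μ) = h(v₁, 0, v₂, 0, …, v_{p+1}, 0, μ)`. -/
def Rop (p s : ℕ) (h : DE p s → ℝ) : DS p s → ℝ :=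
  fun d => h (d.1, 0, d.2)

/-- `v_k(x, ν) = x_0 + 2 Σ_j Re(e^{iω_jτ_k} x_j) + τ_k ν`. -/
def vFull (p : ℕ) (ω : Fin p → ℝ) (τ : Fin (p + 1) → ℝ) (x : V p) (ν : ℝ)
    (k : Fin (p + 1)) : ℝ :=
  x.1 + 2 * ∑ j, (Complex.exp (Complex.I * (ω j : ℂ) * (τ k : ℂ)) * x.2 j).re + τ k * ν

/-- `v_k⁰(x) = x_0 + 2 Σ_j Re(e^{iω_jτ_k} x_j)`. -/
def vSemi (p : ℕ) (ω : Fin p → ℝ) (τ : Fin (p + 1) → ℝ) (x : V p)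
    (k : Fin (p + 1)) : ℝ :=
  x.1 + 2 * ∑ j, (Complex.exp (Complex.I * (ω j : ℂ) * (τ k : ℂ)) * x.2 j).re

/-- `Ψ(0) = (u_0, u_1, …, u_p)`. -/
def Psi0 (p : ℕ) (u0 : ℝ) (u : Fin p → ℂ) : V p := (u0, u)

/-- The operator `E̊^ℓ_τ : H^{2p+2+s}_ℓ(ℝ) → H^{2p+2+s}_ℓ(ℝ^{2p+1})`. -/
def ERing (p s : ℕ) (ω : Fin p → ℝ) (τ : Fin (p + 1) → ℝ) (u0 : ℝ) (u : Fin p → ℂ)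
    (h : DE p s → ℝ) : W p s → V p :=
  fun w => h (fun k => vFull p ω τ w.1 w.2.1 k, fun _ => w.2.1, w.2.2) • Psi0 p u0 u

/-- The operator `E^ℓ_τ : H^{p+1+s}_ℓ(ℝ) → H^{2p+1+s}_ℓ(ℝ^{2p+1})`
(semisimple case, no ν variable). -/
def ESemi (p s : ℕ) (ω : Fin p → ℝ) (τ : Fin (p + 1) → ℝ) (u0 : ℝ) (u : Fin p → ℂ)
    (h : DS p s → ℝ) : V p × (Fin s → ℝ) → V p :=
  fun xμ => h (fun k => vSemi p ω τ xμ.1 k, xμ.2) • Psi0 p u0 u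

/-- The averaging operator `A` in the semisimple (ν-free) case. -/
def ASemi (p s : ℕ) (g : V p × (Fin s → ℝ) → V p) : V p × (Fin s → ℝ) → V p :=
  fun xμ => ((2 * Real.pi) ^ p)⁻¹ •
    ∫ θ in torusBox p, torusAct p θ (g (torusAct p (-θ) xμ.1, xμ.2))

/-- The operator `Π` in the semisimple (ν-free) case. -/
def PiSemi (p s : ℕ) (g : V p × (Fin s → ℝ) → V p) : WZ p s → VZ p :=
  fun w => ((g (embZ p w.1, w.2)).1, fun j => ((g (embZ p w.1, w.2)).2 j).re)

/-- A homogeneous polynomial in `(v, μ)` is homogeneous of the same degree in `(v, w, μ)`. -/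
theorem IsHomogS.comp_fst_snd_snd {p s ℓ : ℕ} {h : DS p s → ℝ} (hh : IsHomogS p s ℓ h) :
    IsHomogE p s ℓ fun d => h (d.1, d.2.2) := by
  obtain ⟨P, hP, hPh⟩ := hh
  refine ⟨MvPolynomial.rename (Sum.map (fun k => (k, true)) id) P,
    hP.rename_isHomogeneous, fun d => ?_⟩
  simp only [MvPolynomial.eval_rename, hPh]
  congr 2
  ext (k | j) <;> simp [coordsS, coordsE]

theorem vFull_zero (p : ℕ) (ω : Fin p → ℝ) (τ : Fin (p + 1) → ℝ) (x : V p) (k : Fin (p + 1)) :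
    vFull p ω τ x 0 k = vSemi p ω τ x k := by
  simp [vFull, vSemi]

/-- On a polynomial not depending on `w`, the non-semisimple map agrees with the semisimple one. -/
theorem Piop_Aop_ERing_comp_fst_snd_snd (p s : ℕ) (ω : Fin p → ℝ) (τ : Fin (p + 1) → ℝ)
    (u0 : ℝ) (u : Fin p → ℂ) (h : DS p s → ℝ) :
    Piop p s (Aop p s (ERing p s ω τ u0 u fun d => h (d.1, d.2.2))) =
      PiSemi p s (ASemi p s (ESemi p s ω τ u0 u h)) := by
  funext w
  simp only [Piop, PiSemi, Aop, ASemi, ERing, ESemi, vFull_zero]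

/-- If the semisimple-case map `Π ∘ A ∘ E^ℓ_τ` is surjective onto
`H^{p+1+s}_ℓ(ℝ^{p+1}, Z_{2,p})`, then so is the non-semisimple map `Π ∘ Å ∘ E̊^ℓ_τ`. -/
theorem surjectivity_transfer_semisimple_to_nonsemisimple
    (p s ℓ : ℕ) (hp : 1 ≤ p) (hℓ : 2 ≤ ℓ)
    (ω : Fin p → ℝ) (hω : ∀ j, 0 < ω j)
    (τ : Fin (p + 1) → ℝ) (u0 : ℝ) (u : Fin p → ℂ)
    (hsurj : ∀ g : WZ p s → VZ p, MemZ p s ℓ g →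
      ∃ h0 : DS p s → ℝ, IsHomogS p s ℓ h0 ∧
        PiSemi p s (ASemi p s (ESemi p s ω τ u0 u h0)) = g) :
    ∀ g : WZ p s → VZ p, MemZ p s ℓ g →
      ∃ h : DE p s → ℝ, IsHomogE p s ℓ h ∧
        Piop p s (Aop p s (ERing p s ω τ u0 u h)) = g := by
  intro g hg
  obtain ⟨h, hh, rfl⟩ := hsurj g hg
  exact ⟨_, hh.comp_fst_snd_snd, Piop_Aop_ERing_comp_fst_snd_snd p s ω τ u0 u h⟩

end
end
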